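/- Fix a positive integer k and let 𝒫̄_k := ∪_{j=0}^{k} 𝒫_j, where 𝒫_j is the set of infinite real symmetric matrices A = (a_ij)_{i,j=1}^∞ whose leading principal n×n submatrices have exactly j negative eigenvalues (counted with multiplicity) for all sufficiently large n. For a function f : ℝ → ℝ, the entrywise transform f[−] maps 𝒫̄_k into 𝒫̄_k if and only if either f(x) = d for all x ∈ ℝ for some real constant d, or f(x) = f(0) + c·x for all x ∈ ℝ with f(0) ≥ 0 and c > 0. -/

import Mathlib

/-- The number of negative eigenvalues (with multiplicity) of a real symmetric
(Hermitian) matrix; junk value `0` if the matrix is not Hermitian. -/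
noncomputable def negEigCount {n : Type*} [Fintype n] [DecidableEq n]
    (A : Matrix n n ℝ) : ℕ :=
  if hA : A.IsHermitian then Nat.card {i // hA.eigenvalues i < 0} else 0

/-- `𝒫ⱼ`: infinite real symmetric matrices whose leading principal `n × n` submatrices have
exactly `j` negative eigenvalues for all sufficiently large `n`. -/
def MemP (j : ℕ) (a : ℕ → ℕ → ℝ) : Prop :=
  (∀ i j', a i j' = a j' i) ∧
  ∃ N : ℕ, ∀ n : ℕ, N ≤ n →
    negEigCount (Matrix.of fun i i' : Fin n => a i.1 i'.1) = j

/-- `𝒫̄ₖ = ∪_{j ≤ k} 𝒫ⱼ`. -/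
def MemPbar (k : ℕ) (a : ℕ → ℕ → ℝ) : Prop := ∃ j : ℕ, j ≤ k ∧ MemP j a

open Matrix in
/-- The quadratic form of `A` is nonnegative on the kernel of `k` linear functionals. -/
def NonnegOnCodim (k : ℕ) {n : Type*} [Fintype n] (A : Matrix n n ℝ) : Prop :=
  ∃ φ : (n → ℝ) →ₗ[ℝ] (Fin k → ℝ), ∀ x, φ x = 0 → 0 ≤ x ⬝ᵥ A *ᵥ x

open Matrix in
theorem Matrix.IsHermitian.exists_dotProduct_mulVec_eq_sum_eigenvalues {n : Type*} [Fintype n]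
    [DecidableEq n] {A : Matrix n n ℝ} (hA : A.IsHermitian) :
    ∃ U : Matrix n n ℝ, Uᵀ * U = 1 ∧
      ∀ x : n → ℝ, x ⬝ᵥ A *ᵥ x = ∑ i, hA.eigenvalues i * (Uᵀ *ᵥ x) i ^ 2 := by
  refine ⟨hA.eigenvectorUnitary, ?_, fun x => ?_⟩
  · simpa [star_eq_conjTranspose] using (mem_unitaryGroup_iff').1 hA.eigenvectorUnitary.2
  · conv_lhs => rw [hA.spectral_theorem]
    rw [Unitary.conjStarAlgAut_apply, ← mulVec_mulVec, ← mulVec_mulVec, dotProduct_mulVec,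
      ← mulVec_transpose]
    simp only [star_eq_conjTranspose, conjTranspose_eq_transpose_of_trivial, dotProduct,
      mulVec_diagonal]
    refine Finset.sum_congr rfl fun i _ => ?_
    simp
    ring

open Matrix in
theorem negEigCount_le_iff {n : Type*} [Fintype n] [DecidableEq n] {A : Matrix n n ℝ}
    (hA : A.IsHermitian) (k : ℕ) : negEigCount A ≤ k ↔ NonnegOnCodim k A := by
  obtain ⟨U, hU, hq⟩ := hA.exists_dotProduct_mulVec_eq_sum_eigenvalues
  rw [negEigCount, dif_pos hA, Nat.card_eq_fintype_card]
  constructor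
  · intro h
    obtain ⟨e⟩ : Nonempty ({i // hA.eigenvalues i < 0} ↪ Fin k) :=
      Function.Embedding.nonempty_of_card_le (by simpa using h)
    refine ⟨Function.ExtendByZero.linearMap ℝ e ∘ₗ LinearMap.funLeft ℝ ℝ Subtype.val ∘ₗ
      Uᵀ.mulVecLin, fun x hx => ?_⟩
    rw [hq]
    refine Finset.sum_nonneg fun i _ => ?_
    rcases lt_or_ge (hA.eigenvalues i) 0 with hi | hi
    · have h0 := congrFun hx (e ⟨i, hi⟩)
      have h1 : (Uᵀ *ᵥ x) i = 0 := by
        simpa [e.injective.extend_apply, LinearMap.funLeft_apply, mulVec_transpose] using h0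
      simp [h1]
    · positivity
  · rintro ⟨φ, hφ⟩
    by_contra! hlt
    let ι : ({i // hA.eigenvalues i < 0} → ℝ) →ₗ[ℝ] (n → ℝ) :=
      Function.ExtendByZero.linearMap ℝ Subtype.val
    have hker : (φ ∘ₗ U.mulVecLin ∘ₗ ι).ker ≠ ⊥ :=
      LinearMap.ker_ne_bot_of_finrank_lt (by simpa using hlt)
    obtain ⟨y, hy, hy0⟩ := Submodule.exists_mem_ne_zero_of_ne_bot hker
    have hnonneg := hφ (U *ᵥ ι y) (by simpa using hy)
    rw [hq, mulVec_mulVec, hU, one_mulVec] at hnonneg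
    obtain ⟨i, hi⟩ := Function.ne_iff.1 hy0
    have hι : ∀ j : {i // hA.eigenvalues i < 0}, ι y j = y j := fun j =>
      Subtype.val_injective.extend_apply _ _ _
    refine absurd hnonneg (not_le.2 (Finset.sum_neg' (fun j _ => ?_) ⟨i, Finset.mem_univ _, ?_⟩))
    · by_cases hj : hA.eigenvalues j < 0
      · exact mul_nonpos_of_nonpos_of_nonneg hj.le (sq_nonneg _)
      · have : ι y j = 0 := Function.extend_apply' _ _ _ (by rintro ⟨⟨l, hl⟩, rfl⟩; exact hj hl)
        simp [this]
    · rw [hι]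
      exact mul_neg_of_neg_of_pos i.2 (sq_pos_of_ne_zero hi)

open Matrix in
theorem NonnegOnCodim.submatrix {k : ℕ} {m n : Type*} [Fintype m] [Fintype n]
    {A : Matrix n n ℝ} (h : NonnegOnCodim k A) (e : m → n) :
    NonnegOnCodim k (A.submatrix e e) := by
  classical
  obtain ⟨φ, hφ⟩ := h
  let P : Matrix n m ℝ := of fun i j => if e j = i then 1 else 0
  have hP : A.submatrix e e = Pᵀ * A * P := by
    ext i j
    simp [P, Matrix.mul_apply]
  refine ⟨φ ∘ₗ P.mulVecLin, fun x hx => ?_⟩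
  rw [hP, ← mulVec_mulVec, ← mulVec_mulVec, dotProduct_mulVec, vecMul_transpose]
  exact hφ _ hx

theorem memPbar_iff (k : ℕ) (a : ℕ → ℕ → ℝ) :
    MemPbar k a ↔ (∀ i j, a i j = a j i) ∧
      ∀ n : ℕ, NonnegOnCodim k (Matrix.of fun i j : Fin n => a i j) := by
  have hherm : (∀ i j, a i j = a j i) → ∀ n : ℕ,
      (Matrix.of fun i j : Fin n => a i j).IsHermitian := fun hs n => by
    ext i j
    simpa using hs _ _
  have hmono : (∀ i j, a i j = a j i) →
      Monotone fun n : ℕ => negEigCount (Matrix.of fun i j : Fin n => a i j) := by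
    intro hs m n hmn
    exact (negEigCount_le_iff (hherm hs m) _).2
      (((negEigCount_le_iff (hherm hs n) _).1 le_rfl).submatrix (Fin.castLE hmn))
  constructor
  · rintro ⟨j, hj, hs, N, hN⟩
    refine ⟨hs, fun n => (negEigCount_le_iff (hherm hs n) k).1 ?_⟩
    exact (hmono hs (le_max_left n N)).trans ((hN _ (le_max_right n N)).le.trans hj)
  · rintro ⟨hs, h⟩
    have hle : ∀ n : ℕ, negEigCount (Matrix.of fun i j : Fin n => a i j) ≤ k := fun n =>
      (negEigCount_le_iff (hherm hs n) k).2 (h n)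
    have hbdd : BddAbove (Set.range fun n : ℕ =>
        negEigCount (Matrix.of fun i j : Fin n => a i j)) := ⟨k, by rintro _ ⟨n, rfl⟩; exact hle n⟩
    obtain ⟨N, hN⟩ := Nat.sSup_mem (Set.range_nonempty _) hbdd
    refine ⟨_, hle N, hs, N, fun n hn => le_antisymm ?_ (hmono hs hn)⟩
    exact (le_csSup hbdd ⟨n, rfl⟩).trans hN.ge

/-- An entrywise preserver of `𝒫̄ₖ` preserves `NonnegOnCodim k` for finite symmetric matrices:
pull the finite matrix back along a surjection from `ℕ`. -/
theorem NonnegOnCodim.map_of_preserves {k : ℕ} {f : ℝ → ℝ}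
    (hf : ∀ a : ℕ → ℕ → ℝ, MemPbar k a → MemPbar k (fun i j => f (a i j)))
    {n : Type*} [Fintype n] [Nonempty n] {A : Matrix n n ℝ} (hs : ∀ i j, A i j = A j i)
    (hA : NonnegOnCodim k A) : NonnegOnCodim k (A.map f) := by
  obtain ⟨e, he⟩ := exists_surjective_nat n
  have h := ((memPbar_iff k _).1 (hf (fun i j => A (e i) (e j))
    ((memPbar_iff k _).2 ⟨fun i j => hs _ _, fun m => hA.submatrix fun i : Fin m => e i⟩))).2
  choose s hs' using he
  obtain ⟨N, hN⟩ := (Finset.univ.image s).exists_le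
  have hlt : ∀ i, s i < N + 1 := fun i =>
    Nat.lt_succ_of_le (hN _ (Finset.mem_image_of_mem _ (Finset.mem_univ i)))
  convert (h (N + 1)).submatrix fun i => (⟨s i, hlt i⟩ : Fin (N + 1))
  ext i j
  simp [hs']

/-- The sum of `!![α, β; β, α] ⊗ J` and `!![γ, δ; δ, γ] ⊗ 1`, with `J` the all-ones matrix. -/
def blockMatrix (N : ℕ) (α β γ δ : ℝ) : Matrix (Fin N × Fin 2) (Fin N × Fin 2) ℝ :=
  Matrix.of fun x y => (if x.2 = y.2 then α else β) +
    if x.1 = y.1 then (if x.2 = y.2 then γ else δ) else 0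

open Matrix in
theorem dotProduct_blockMatrix_mulVec (N : ℕ) (α β γ δ : ℝ) (x : Fin N × Fin 2 → ℝ) :
    x ⬝ᵥ blockMatrix N α β γ δ *ᵥ x =
      α * ((∑ p, x (p, 0)) ^ 2 + (∑ p, x (p, 1)) ^ 2)
        + 2 * β * ((∑ p, x (p, 0)) * ∑ p, x (p, 1))
        + ∑ p, (γ * (x (p, 0) ^ 2 + x (p, 1) ^ 2) + 2 * δ * (x (p, 0) * x (p, 1))) := by
  have hrow : ∀ p, ∀ i : Fin 2, (blockMatrix N α β γ δ *ᵥ x) (p, i) =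
      (if i = 0 then α else β) * ∑ q, x (q, 0) + (if i = 1 then α else β) * ∑ q, x (q, 1)
        + ((if i = 0 then γ else δ) * x (p, 0) + (if i = 1 then γ else δ) * x (p, 1)) := by
    intro p i
    simp only [mulVec, dotProduct, blockMatrix, of_apply, Fintype.sum_prod_type,
      Fin.sum_univ_two, add_mul, ite_mul, zero_mul, Finset.sum_add_distrib, Finset.sum_ite_eq,
      Finset.mem_univ, if_true, Finset.mul_sum]
  rw [dotProduct, Fintype.sum_prod_type]
  simp only [hrow, Fin.sum_univ_two, Finset.sum_add_distrib, mul_add]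
  simp only [if_true, zero_ne_one, one_ne_zero, if_false, ← mul_assoc, ← Finset.sum_mul]
  simp only [mul_comm _ α, mul_comm _ β, mul_assoc, ← Finset.mul_sum,
    mul_left_comm _ γ, mul_left_comm _ δ]
  simp only [mul_comm (x (_, 1)) (x (_, 0)), pow_two]
  ring

/-- If `!![a, b; b, a]` has at most one negative eigenvalue, then so does `blockMatrix N a b ε ε`,
and the eigenvalues of the increment of `f` over `!![a, b; b, a]` are nonnegative. -/
theorem increment_add_nonneg_of_preserves {k : ℕ} (hk : 1 ≤ k) {f : ℝ → ℝ}
    (hf : ∀ a : ℕ → ℕ → ℝ, MemPbar k a → MemPbar k (fun i j => f (a i j)))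
    {a b ε s σ : ℝ} (hε : 0 ≤ ε) (hs : s ^ 2 = 1) (hσ : σ ^ 2 = 1) (hab : 0 ≤ a + s * b) :
    0 ≤ (f (a + ε) - f a) + σ * (f (b + ε) - f b) := by
  have hA : NonnegOnCodim k (blockMatrix (k + 2) a b ε ε) := by
    refine ⟨LinearMap.pi fun _ =>
      ∑ p, (LinearMap.proj (p, 0) - s • LinearMap.proj (p, 1)), fun x hx => ?_⟩
    have h0 : ∑ p, x (p, 0) = s * ∑ p, x (p, 1) := by
      have := congrFun hx ⟨0, hk⟩
      simp only [LinearMap.pi_apply, LinearMap.sum_apply, LinearMap.sub_apply,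
        LinearMap.smul_apply, LinearMap.proj_apply, smul_eq_mul, Finset.sum_sub_distrib,
        ← Finset.mul_sum, Pi.zero_apply] at this
      linarith
    rw [dotProduct_blockMatrix_mulVec, h0]
    refine add_nonneg ?_ (Finset.sum_nonneg fun p _ => ?_)
    · have : 0 ≤ 2 * (a + s * b) * (∑ p, x (p, 1)) ^ 2 := by positivity
      linear_combination this - a * (∑ p, x (p, 1)) ^ 2 * hs
    · have : 0 ≤ ε * (x (p, 0) + x (p, 1)) ^ 2 := by positivity
      linear_combination this
  obtain ⟨ψ, hψ⟩ := hA.map_of_preserves hf fun x y => by simp [blockMatrix, eq_comm]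
  have hmap : (blockMatrix (k + 2) a b ε ε).map f =
      blockMatrix (k + 2) (f a) (f b) (f (a + ε) - f a) (f (b + ε) - f b) := by
    ext x y
    simp only [blockMatrix, Matrix.map_apply, Matrix.of_apply]
    split_ifs <;> simp
  rw [hmap] at hψ
  let τ : (Fin (k + 2) → ℝ) →ₗ[ℝ] (Fin (k + 2) × Fin 2 → ℝ) :=
    LinearMap.pi fun x => (if x.2 = 0 then 1 else σ) • LinearMap.proj x.1
  have hker : ((ψ ∘ₗ τ).prod (∑ p, LinearMap.proj p : (Fin (k + 2) → ℝ) →ₗ[ℝ] ℝ)).ker ≠ ⊥ :=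
    LinearMap.ker_ne_bot_of_finrank_lt (by simp)
  obtain ⟨y, hy, hy0⟩ := Submodule.exists_mem_ne_zero_of_ne_bot hker
  rw [LinearMap.ker_prod, Submodule.mem_inf, LinearMap.mem_ker, LinearMap.mem_ker] at hy
  have hsum : ∑ p, y p = 0 := by simpa [LinearMap.sum_apply] using hy.2
  have h := hψ (τ y) hy.1
  have hτ0 : ∀ p, τ y (p, 0) = y p := fun p => by simp [τ]
  have hτ1 : ∀ p, τ y (p, 1) = σ * y p := fun p => by simp [τ]
  simp only [dotProduct_blockMatrix_mulVec, hτ0, hτ1, ← Finset.mul_sum, hsum] at h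
  have hpos : 0 < ∑ p, y p ^ 2 := by
    obtain ⟨p, hp⟩ := Function.ne_iff.1 hy0
    exact Finset.sum_pos' (fun _ _ => sq_nonneg _)
      ⟨p, Finset.mem_univ _, sq_pos_of_ne_zero hp⟩
  have heq : ∑ p, ((f (a + ε) - f a) * (y p ^ 2 + (σ * y p) ^ 2)
      + 2 * (f (b + ε) - f b) * (y p * (σ * y p))) =
      2 * ((f (a + ε) - f a) + σ * (f (b + ε) - f b)) * ∑ p, y p ^ 2 := by
    rw [Finset.mul_sum]
    refine Finset.sum_congr rfl fun p _ => ?_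
    linear_combination (f (a + ε) - f a) * y p ^ 2 * hσ
  rw [heq] at h
  by_contra! hneg
  nlinarith [mul_neg_of_neg_of_pos hneg hpos]

theorem increment_eq_of_preserves {k : ℕ} (hk : 1 ≤ k) {f : ℝ → ℝ}
    (hf : ∀ a : ℕ → ℕ → ℝ, MemPbar k a → MemPbar k (fun i j => f (a i j)))
    {ε : ℝ} (hε : 0 ≤ ε) (x : ℝ) : f (x + ε) - f x = f ε - f 0 := by
  have key : ∀ {a b : ℝ}, -|b| ≤ a → f (b + ε) - f b ≤ f (a + ε) - f a := by
    intro a b hab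
    rcases abs_cases b with ⟨h, _⟩ | ⟨h, _⟩
    · linarith [increment_add_nonneg_of_preserves hk hf (s := 1) (σ := -1) hε (by norm_num)
        (by norm_num) (show 0 ≤ a + 1 * b by linarith)]
    · linarith [increment_add_nonneg_of_preserves hk hf (s := -1) (σ := -1) hε (by norm_num)
        (by norm_num) (show 0 ≤ a + -1 * b by linarith)]
  have hzero : f (0 + ε) - f 0 = f (|x| + ε) - f |x| :=
    le_antisymm (key (by simp)) (key (by simp))
  have habs : f (x + ε) - f x = f (|x| + ε) - f |x| :=
    le_antisymm (key (by linarith [abs_nonneg x])) (key (by simpa using neg_abs_le x))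
  rw [habs, ← hzero, zero_add]

theorem exists_affine_of_preserves {k : ℕ} (hk : 1 ≤ k) {f : ℝ → ℝ}
    (hf : ∀ a : ℕ → ℕ → ℝ, MemPbar k a → MemPbar k (fun i j => f (a i j))) :
    ∃ c : ℝ, 0 ≤ c ∧ ∀ x, f x = f 0 + c * x := by
  have hinc := fun x ε (hε : 0 ≤ ε) => increment_eq_of_preserves hk hf hε x
  have hnonneg : ∀ ε, 0 ≤ ε → 0 ≤ f ε - f 0 := fun ε hε => by
    have := increment_add_nonneg_of_preserves hk hf (a := 0) (b := 0) (s := 1) (σ := 1) hε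
      (by norm_num) (by norm_num) (by norm_num)
    rw [zero_add] at this
    linarith
  have hmono : Monotone f := fun x y hxy => by
    have := hinc x (y - x) (by linarith)
    rw [add_sub_cancel] at this
    linarith [hnonneg (y - x) (by linarith)]
  let g : ℝ →+ ℝ :=
    { toFun := fun x => f x - f 0
      map_zero' := sub_self _
      map_add' := fun x y => by
        rcases le_total 0 y with hy | hy
        · linarith [hinc x y hy]
        · have h1 := hinc (x + y) (-y) (by linarith)
          have h2 := hinc y (-y) (by linarith)
          rw [add_neg_cancel_right] at h1
          rw [add_neg_cancel] at h2
          linarith }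
  have hg : Continuous g :=
    MeasureTheory.Measure.AddMonoidHom.continuous_of_measurable g (hmono.measurable.sub_const _)
  refine ⟨f 1 - f 0, hnonneg 1 zero_le_one, fun x => ?_⟩
  have := map_real_smul g hg x 1
  simp only [smul_eq_mul, mul_one] at this
  change f x - f 0 = x * (f 1 - f 0) at this
  linarith

open Matrix in
theorem dotProduct_map_affine_mulVec {n : Type*} [Fintype n] {f : ℝ → ℝ} {c : ℝ}
    (hfc : ∀ x, f x = f 0 + c * x) (A : Matrix n n ℝ) (x : n → ℝ) :
    x ⬝ᵥ A.map f *ᵥ x = f 0 * (∑ i, x i) ^ 2 + c * (x ⬝ᵥ A *ᵥ x) := by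
  have hrow : ∀ i, (A.map f *ᵥ x) i = f 0 * ∑ j, x j + c * (A *ᵥ x) i := fun i => by
    simp only [mulVec, dotProduct, map_apply, Finset.mul_sum, ← Finset.sum_add_distrib]
    refine Finset.sum_congr rfl fun j _ => ?_
    rw [hfc]
    ring
  simp only [dotProduct, hrow, mul_add, Finset.sum_add_distrib, ← Finset.sum_mul, pow_two,
    Finset.mul_sum (a := c), mul_left_comm _ c]
  ring

open Matrix in
theorem map_zero_nonneg_of_preserves {k : ℕ} {f : ℝ → ℝ}
    (hf : ∀ a : ℕ → ℕ → ℝ, MemPbar k a → MemPbar k (fun i j => f (a i j)))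
    {c : ℝ} (hc : 0 < c) (hfc : ∀ x, f x = f 0 + c * x) : 0 ≤ f 0 := by
  by_contra! hneg
  let d : Fin (k + 1) → ℝ := Fin.snoc (fun _ => -1) 0
  have hquad : ∀ x : Fin (k + 1) → ℝ,
      x ⬝ᵥ diagonal d *ᵥ x = -∑ i : Fin k, x i.castSucc ^ 2 := fun x => by
    simp [dotProduct, mulVec_diagonal, Fin.sum_univ_castSucc, d, pow_two]
  have hA : NonnegOnCodim k (diagonal d) := by
    refine ⟨LinearMap.funLeft ℝ ℝ Fin.castSucc, fun x hx => ?_⟩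
    rw [hquad]
    simp [show ∀ i : Fin k, x i.castSucc = 0 from fun i => congrFun hx i]
  obtain ⟨ψ, hψ⟩ := hA.map_of_preserves hf fun i j => by
    rw [← transpose_apply (diagonal d), diagonal_transpose]
  obtain ⟨y, hy, hy0⟩ := Submodule.exists_mem_ne_zero_of_ne_bot
    (LinearMap.ker_ne_bot_of_finrank_lt (f := ψ) (by simp))
  have h := hψ y hy
  rw [dotProduct_map_affine_mulVec hfc, hquad] at h
  have hS : 0 ≤ ∑ i : Fin k, y i.castSucc ^ 2 := Finset.sum_nonneg fun _ _ => sq_nonneg _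
  have hT := sq_nonneg (∑ i, y i)
  have hS0 : ∑ i : Fin k, y i.castSucc ^ 2 = 0 := by nlinarith
  have hT0 : (∑ i, y i) ^ 2 = 0 := by nlinarith
  have hinit : ∀ i : Fin k, y i.castSucc = 0 := fun i => by
    simpa using (Finset.sum_eq_zero_iff_of_nonneg fun _ _ => sq_nonneg _).1 hS0 i
      (Finset.mem_univ _)
  refine hy0 (funext (Fin.lastCases ?_ hinit))
  simpa [Fin.sum_univ_castSucc, hinit] using hT0

/-- Theorem 3.7(2): for positive `k`, the entrywise transform `f[-]` maps `𝒫̄ₖ` into `𝒫̄ₖ`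
if and only if `f` is constant, or `f(x) = f(0) + c x` with `f(0) ≥ 0` and `c > 0`. -/
theorem pontryagin_gram_closure_preserver_iff (k : ℕ) (hk : 1 ≤ k) (f : ℝ → ℝ) :
    (∀ a : ℕ → ℕ → ℝ, MemPbar k a → MemPbar k (fun i j => f (a i j))) ↔
    ((∃ d : ℝ, ∀ x : ℝ, f x = d) ∨
     (0 ≤ f 0 ∧ ∃ c : ℝ, 0 < c ∧ ∀ x : ℝ, f x = f 0 + c * x)) := by
  constructor
  · intro hf
    obtain ⟨c, hc, hfc⟩ := exists_affine_of_preserves hk hf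
    rcases hc.eq_or_lt with rfl | hc
    · exact Or.inl ⟨f 0, fun x => by simpa using hfc x⟩
    · exact Or.inr ⟨map_zero_nonneg_of_preserves hf hc hfc, c, hc, hfc⟩
  · intro h a ha
    rw [memPbar_iff] at ha ⊢
    refine ⟨fun i j => by rw [ha.1 i j], fun n => ?_⟩
    change NonnegOnCodim k ((Matrix.of fun i j : Fin n => a i j).map f)
    rcases h with ⟨d, hd⟩ | ⟨h0, c, hc, hfc⟩
    · refine ⟨LinearMap.pi fun _ => ∑ i, LinearMap.proj i, fun x hx => ?_⟩
      have hsum : ∑ i, x i = 0 := by simpa [LinearMap.sum_apply] using congrFun hx ⟨0, hk⟩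
      rw [dotProduct_map_affine_mulVec (c := 0) (by simp [hd]), hsum]
      simp
    · obtain ⟨φ, hφ⟩ := ha.2 n
      refine ⟨φ, fun x hx => ?_⟩
      rw [dotProduct_map_affine_mulVec hfc]
      have := hφ x hx
      positivity
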